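/- arXiv:2503.23238 — 3 statements merged into one kernel-verified Lean document; each statement's English description precedes it below -/
import Mathlib

section
/- For every real δ ∈ [0,1], if a discrete random variable X on a countable set 𝒳 is δ-similar to a probability distribution D on 𝒳, then X is within statistical distance δ of D, i.e. (1/2)·Σ_{x∈𝒳} |Pr[X = x] − D(x)| ≤ δ. -/
/-- If a discrete random variable `X` (with distribution `p`) on a
countable set `𝒳` is `δ`-similar to a probability distribution `D` on `𝒳`, for some
`δ ∈ [0,1]`, then `X` is within statistical distance `δ` of `D`. -/
theorem similar_implies_statDist_le {𝒳 : Type*} [Countable 𝒳]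
    (δ : ℝ) (hδ0 : 0 ≤ δ) (hδ1 : δ ≤ 1)
    (p D : 𝒳 → ℝ)
    (hp0 : ∀ x, 0 ≤ p x) (hp1 : ∑' x, p x = 1)
    (hD0 : ∀ x, 0 ≤ D x) (hD1 : ∑' x, D x = 1)
    (hsim : ∀ x, p x ∈ Set.Icc (Real.exp (-δ) * D x) (Real.exp δ * D x)) :
    (1 / 2) * ∑' x, |p x - D x| ≤ δ := by
  have hD : Summable D := by
    by_contra h
    rw [tsum_eq_zero_of_not_summable h] at hD1
    norm_num at hD1
  have h1 : Real.exp δ - 1 ≤ 2 * δ := by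
    have h := Real.abs_exp_sub_one_le (x := δ) (by rw [abs_of_nonneg hδ0]; exact hδ1)
    rw [abs_of_nonneg hδ0] at h
    exact (le_abs_self _).trans h
  have h2 : 1 - δ ≤ Real.exp (-δ) := by
    have h := Real.add_one_le_exp (-δ)
    linarith
  have hb : ∀ x, |p x - D x| ≤ 2 * δ * D x := by
    intro x
    obtain ⟨ha, hc⟩ := hsim x
    have e1 := mul_le_mul_of_nonneg_right h1 (hD0 x)
    have e2 := mul_le_mul_of_nonneg_right h2 (hD0 x)
    have e3 := mul_nonneg hδ0 (hD0 x)
    rw [abs_le]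
    constructor <;> linarith
  have hs : Summable fun x => 2 * δ * D x := hD.mul_left _
  have hs' : Summable fun x => |p x - D x| :=
    Summable.of_nonneg_of_le (fun x => abs_nonneg _) hb hs
  have hle := hs'.tsum_le_tsum hb hs
  rw [tsum_mul_left, hD1] at hle
  linarith
end

section
/- Let n, m, q be positive integers with q prime and q^{1−n/m} ≥ 6. For a uniformly random matrix A ∈ ℤ_q^{n×m}, the probability that λ₁^∞(Λ_q(A)) ≤ (q^{1−n/m} · 2^{−n/m})/3 is less than 2^{−n}. In particular, if m ≥ n, then except with probability less than 2^{−n}, λ₁^∞(Λ_q(A)) > q^{1−n/m}/6. -/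
noncomputable section

/-- The minimal `ℓ_∞`-norm of a nonzero vector of a set `L` of integer vectors
(the sup norm is the norm of the product type `Fin m → ℤ`). -/
noncomputable def lamInfZ {m : ℕ} (L : Set (Fin m → ℤ)) : ℝ :=
  sInf {t : ℝ | ∃ y ∈ L, y ≠ 0 ∧ t = ‖y‖}

/-- The `q`-ary lattice `Λ_q(A) = Aᵀℤ^n + qℤ^m ⊆ ℤ^m`. -/
def LambdaQ {n m q : ℕ} (A : Matrix (Fin n) (Fin m) (ZMod q)) : Set (Fin m → ℤ) :=
  {y | ∃ s : Fin n → ZMod q, ∀ j, (y j : ZMod q) = ∑ i, A i j * s i}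

/-- The probability that a uniformly random matrix `A ∈ ℤ_q^{n×m}` satisfies `P`. -/
noncomputable def matProb (n m q : ℕ) (P : Matrix (Fin n) (Fin m) (ZMod q) → Prop) : ℝ :=
  (Nat.card {A : Matrix (Fin n) (Fin m) (ZMod q) // P A} : ℝ) /
    (Nat.card (Matrix (Fin n) (Fin m) (ZMod q)) : ℝ)

theorem fiber_card (n m q : ℕ) [Fact q.Prime] (s : Fin n → ZMod q) (hs : s ≠ 0)
    (t : Fin m → ZMod q) :
    Nat.card {A : Matrix (Fin n) (Fin m) (ZMod q) // ∀ j, t j = ∑ i, A i j * s i} * q ^ m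
      ≤ Nat.card (Matrix (Fin n) (Fin m) (ZMod q)) := by
  classical
  obtain ⟨i0, hi0⟩ := Function.ne_iff.mp hs
  have h0 : s i0 ≠ 0 := by simpa using hi0
  have hc : q ^ m = Nat.card (Fin m → ZMod q) := by simp
  rw [hc, ← Nat.card_prod]
  let f : {A : Matrix (Fin n) (Fin m) (ZMod q) // ∀ j, t j = ∑ i, A i j * s i}
      × (Fin m → ZMod q) → Matrix (Fin n) (Fin m) (ZMod q) :=
    fun p => fun i j => p.1.1 i j + if i = i0 then p.2 j else 0
  have hf : ∀ p j, ∑ i, f p i j * s i = t j + p.2 j * s i0 := by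
    intro p j
    simp only [f, add_mul, Finset.sum_add_distrib, ← p.1.2 j]
    simp
  apply Nat.card_le_card_of_injective f
  intro p p' h
  have h2 : p.2 = p'.2 := by
    funext j
    have h1 := hf p j
    rw [h, hf p' j] at h1
    have := add_left_cancel h1
    exact (mul_right_cancel₀ h0 this).symm
  have h1 : p.1 = p'.1 := by
    apply Subtype.ext
    funext i j
    have h3 := congrFun (congrFun h i) j
    simp only [f, h2] at h3
    exact add_right_cancel h3
  exact Prod.ext h1 h2

theorem exists_short (n m q : ℕ) (hm : 0 < m) (hq : q.Prime) (B : ℝ) (hB : 0 ≤ B) (hBq : B < q)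
    (A : Matrix (Fin n) (Fin m) (ZMod q)) (h : lamInfZ (LambdaQ A) ≤ B) :
    ∃ s : Fin n → ZMod q, s ≠ 0 ∧ ∃ y : Fin m → ℤ,
      y ∈ Fintype.piFinset (fun _ : Fin m => Finset.Icc (-(⌊B⌋₊ : ℤ)) ⌊B⌋₊) ∧
      ∀ j, (y j : ZMod q) = ∑ i, A i j * s i := by
  have hex : ∃ y ∈ LambdaQ A, y ≠ 0 ∧ ‖y‖ < (⌊B⌋₊ : ℝ) + 1 := by
    by_contra! hcon
    have hle : (⌊B⌋₊ : ℝ) + 1 ≤ lamInfZ (LambdaQ A) := by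
      apply le_csInf
      · refine ⟨_, fun _ => (q : ℤ), ⟨0, ?_⟩, ?_, rfl⟩
        · intro j; simp
        · intro h0
          have := congrFun h0 ⟨0, hm⟩
          simp at this
          exact hq.ne_zero this
      · rintro t ⟨y, hy, hy0, rfl⟩
        exact hcon y hy hy0
    have := Nat.lt_floor_add_one B
    linarith
  haveI : Fact q.Prime := ⟨hq⟩
  obtain ⟨y, ⟨s, hs⟩, hy0, hyn⟩ := hex
  have hyj : ∀ j, |y j| ≤ (⌊B⌋₊ : ℤ) := by
    intro j
    have h1 := (norm_le_pi_norm y j).trans_lt hyn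
    rw [Int.norm_eq_abs] at h1
    have h2 : |y j| < (⌊B⌋₊ : ℤ) + 1 := by exact_mod_cast h1
    omega
  refine ⟨s, ?_, y, ?_, hs⟩
  · rintro rfl
    apply hy0
    funext j
    have h1 := hs j
    simp only [Pi.zero_apply, mul_zero, Finset.sum_const_zero] at h1
    rw [ZMod.intCast_zmod_eq_zero_iff_dvd] at h1
    refine Int.eq_zero_of_abs_lt_dvd h1 ((hyj j).trans_lt ?_)
    have : ⌊B⌋₊ < q := (Nat.floor_lt hB).2 hBq
    exact_mod_cast this
  · rw [Fintype.mem_piFinset]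
    intro j
    rw [Finset.mem_Icc]
    exact abs_le.mp (hyj j)

theorem bad_card (n m q : ℕ) (hm : 0 < m) (hq : q.Prime) (B : ℝ) (hB : 0 ≤ B) (hBq : B < q) :
    Nat.card {A : Matrix (Fin n) (Fin m) (ZMod q) // lamInfZ (LambdaQ A) ≤ B} * q ^ m
      ≤ (q ^ n - 1) * (2 * ⌊B⌋₊ + 1) ^ m * Nat.card (Matrix (Fin n) (Fin m) (ZMod q)) := by
  classical
  haveI : Fact q.Prime := ⟨hq⟩
  let S : Finset (Fin n → ZMod q) := Finset.univ.erase 0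
  let Y := Fintype.piFinset (fun _ : Fin m => Finset.Icc (-(⌊B⌋₊ : ℤ)) ⌊B⌋₊)
  let F : (Fin n → ZMod q) × (Fin m → ℤ) → Finset (Matrix (Fin n) (Fin m) (ZMod q)) :=
    fun p => Finset.univ.filter (fun A => ∀ j, (p.2 j : ZMod q) = ∑ i, A i j * p.1 i)
  have hS : S.card = q ^ n - 1 := by simp [S, Finset.card_erase_of_mem]
  have hY : Y.card = (2 * ⌊B⌋₊ + 1) ^ m := by
    simp only [Y, Fintype.card_piFinset, Int.card_Icc, Finset.prod_const, Finset.card_univ,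
      Fintype.card_fin]
    congr 1
    omega
  have hbad : Nat.card {A : Matrix (Fin n) (Fin m) (ZMod q) // lamInfZ (LambdaQ A) ≤ B}
      ≤ ∑ p ∈ S ×ˢ Y, (F p).card := by
    rw [Nat.card_eq_fintype_card, Fintype.card_subtype]
    refine (Finset.card_le_card ?_).trans Finset.card_biUnion_le
    intro A hA
    obtain ⟨s, hs, y, hy, h⟩ := exists_short n m q hm hq B hB hBq A (Finset.mem_filter.mp hA).2
    rw [Finset.mem_biUnion]
    exact ⟨(s, y), Finset.mem_product.mpr ⟨by simp [S, hs], hy⟩, by simpa [F] using h⟩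
  calc _ ≤ (∑ p ∈ S ×ˢ Y, (F p).card) * q ^ m := Nat.mul_le_mul_right _ hbad
    _ = ∑ p ∈ S ×ˢ Y, (F p).card * q ^ m := Finset.sum_mul ..
    _ ≤ ∑ p ∈ S ×ˢ Y, Nat.card (Matrix (Fin n) (Fin m) (ZMod q)) := by
        apply Finset.sum_le_sum
        rintro ⟨s, y⟩ hp
        have hs : s ≠ 0 := by
          have := (Finset.mem_product.mp hp).1
          simpa [S] using this
        have := fiber_card n m q s hs (fun j => (y j : ZMod q))
        rw [Nat.card_eq_fintype_card, Fintype.card_subtype] at this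
        exact this
    _ = _ := by rw [Finset.sum_const, Finset.card_product, hS, hY, smul_eq_mul]

/-- For `q` prime with `q^{1−n/m} ≥ 6`, a uniformly random matrix
`A ∈ ℤ_q^{n×m}` satisfies `λ₁^∞(Λ_q(A)) ≤ (q^{1−n/m}·2^{−n/m})/3` with probability
less than `2^{−n}`; in particular, if `m ≥ n`, then except with probability `< 2^{−n}`
one has `λ₁^∞(Λ_q(A)) > q^{1−n/m}/6`. -/
theorem lambda_one_inf_qary_lower_bound (n m q : ℕ) (hn : 0 < n) (hm : 0 < m)
    (hq : q.Prime) (hbig : (6 : ℝ) ≤ (q : ℝ) ^ ((1 : ℝ) - (n : ℝ) / (m : ℝ))) :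
    matProb n m q (fun A => lamInfZ (LambdaQ A) ≤
        (q : ℝ) ^ ((1 : ℝ) - (n : ℝ) / (m : ℝ)) * (2 : ℝ) ^ (-(n : ℝ) / (m : ℝ)) / 3)
      < (1 / 2 : ℝ) ^ n
    ∧ (n ≤ m →
        matProb n m q (fun A => ¬ ((q : ℝ) ^ ((1 : ℝ) - (n : ℝ) / (m : ℝ)) / 6
            < lamInfZ (LambdaQ A)))
          < (1 / 2 : ℝ) ^ n) := by
  have hmR : (0 : ℝ) < m := by exact_mod_cast hm
  have hnR : (0 : ℝ) < n := by exact_mod_cast hn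
  have hq0 : (0 : ℝ) < q := by exact_mod_cast hq.pos
  have hq1 : (1 : ℝ) < q := by exact_mod_cast hq.one_lt
  haveI : Fact q.Prime := ⟨hq⟩
  have hnm : (n : ℝ) / m < 1 := by
    by_contra! hcon
    have := Real.rpow_le_one_of_one_le_of_nonpos hq1.le (by linarith : (1 : ℝ) - n / m ≤ 0)
    linarith
  have h2 : (1 / 2 : ℝ) < (2 : ℝ) ^ (-(n : ℝ) / (m : ℝ)) := by
    have : (2 : ℝ) ^ (-1 : ℝ) < (2 : ℝ) ^ (-(n : ℝ) / (m : ℝ)) := by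
      apply Real.rpow_lt_rpow_of_exponent_lt (by norm_num)
      rw [neg_div]; linarith
    rw [Real.rpow_neg_one] at this
    linarith
  have h2' : (2 : ℝ) ^ (-(n : ℝ) / (m : ℝ)) ≤ 1 := by
    apply Real.rpow_le_one_of_one_le_of_nonpos (by norm_num)
    rw [neg_div]
    have : 0 < (n : ℝ) / m := by positivity
    linarith
  have hQ : (q : ℝ) ^ ((1 : ℝ) - (n : ℝ) / (m : ℝ)) ≤ q := by
    conv_rhs => rw [← Real.rpow_one (q : ℝ)]
    apply Real.rpow_le_rpow_of_exponent_le hq1.le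
    have : 0 < (n : ℝ) / m := by positivity
    linarith
  have hpow : ((q : ℝ) ^ ((1 : ℝ) - (n : ℝ) / (m : ℝ)) * (2 : ℝ) ^ (-(n : ℝ) / (m : ℝ))) ^ m
      * (q : ℝ) ^ n = (q : ℝ) ^ m * (1 / 2 : ℝ) ^ n := by
    rw [mul_pow, ← Real.rpow_mul_natCast hq0.le, ← Real.rpow_mul_natCast (by norm_num)]
    have e1 : ((1 : ℝ) - (n : ℝ) / (m : ℝ)) * m = (m : ℝ) - n := by field_simp
    have e2 : (-(n : ℝ) / (m : ℝ)) * m = -(n : ℝ) := by field_simp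
    rw [e1, e2, Real.rpow_sub hq0, Real.rpow_neg (by norm_num), Real.rpow_natCast,
      Real.rpow_natCast, Real.rpow_natCast, one_div, inv_pow]
    field_simp
  set Q := (q : ℝ) ^ ((1 : ℝ) - (n : ℝ) / (m : ℝ)) with hQdef
  set T := (2 : ℝ) ^ (-(n : ℝ) / (m : ℝ)) with hTdef
  have hB1 : 1 ≤ Q * T / 3 := by nlinarith
  have hBq : Q * T / 3 < q := by nlinarith
  have hN : (0 : ℝ) < (Nat.card (Matrix (Fin n) (Fin m) (ZMod q)) : ℝ) := by
    exact_mod_cast Nat.card_pos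
  have key : matProb n m q (fun A => lamInfZ (LambdaQ A) ≤ Q * T / 3) < (1 / 2 : ℝ) ^ n := by
    have hb := bad_card n m q hm hq (Q * T / 3) (by linarith) hBq
    unfold matProb
    rw [div_lt_iff₀ hN]
    have hb' : (Nat.card {A : Matrix (Fin n) (Fin m) (ZMod q) //
        lamInfZ (LambdaQ A) ≤ Q * T / 3} : ℝ) * (q : ℝ) ^ m
        ≤ ((q : ℝ) ^ n - 1) * (2 * (⌊Q * T / 3⌋₊ : ℝ) + 1) ^ m *
          (Nat.card (Matrix (Fin n) (Fin m) (ZMod q)) : ℝ) := by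
      have h3 : ((q ^ n - 1 : ℕ) : ℝ) = (q : ℝ) ^ n - 1 := by
        rw [Nat.cast_sub (Nat.one_le_pow _ _ hq.pos)]; simp
      rw [← h3]
      exact_mod_cast hb
    have hfl : 2 * (⌊Q * T / 3⌋₊ : ℝ) + 1 ≤ Q * T := by
      have := Nat.floor_le (by linarith : 0 ≤ Q * T / 3)
      linarith
    have h4 : (2 * (⌊Q * T / 3⌋₊ : ℝ) + 1) ^ m ≤ (Q * T) ^ m :=
      pow_le_pow_left₀ (by positivity) hfl m
    have h5 : 0 < (Q * T) ^ m := pow_pos (by linarith) m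
    have h6 : (1 : ℝ) < (q : ℝ) ^ n := one_lt_pow₀ hq1 hn.ne'
    have h7 : ((q : ℝ) ^ n - 1) * (2 * (⌊Q * T / 3⌋₊ : ℝ) + 1) ^ m
        < (q : ℝ) ^ m * (1 / 2 : ℝ) ^ n := by
      have := mul_le_mul_of_nonneg_left h4 (by linarith : 0 ≤ (q : ℝ) ^ n - 1)
      nlinarith
    have h8 := mul_lt_mul_of_pos_right h7 hN
    have h9 : (0 : ℝ) < (q : ℝ) ^ m := by positivity
    refine lt_of_mul_lt_mul_right ?_ h9.le
    calc _ ≤ _ := hb'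
      _ < _ := h8
      _ = _ := by ring
  refine ⟨key, fun _ => lt_of_le_of_lt ?_ key⟩
  unfold matProb
  refine div_le_div_of_nonneg_right ?_ hN.le
  have : Nat.card {A : Matrix (Fin n) (Fin m) (ZMod q) // ¬ (Q / 6 < lamInfZ (LambdaQ A))}
      ≤ Nat.card {A : Matrix (Fin n) (Fin m) (ZMod q) // lamInfZ (LambdaQ A) ≤ Q * T / 3} := by
    refine Nat.card_le_card_of_injective
      (Subtype.map id (fun A hA => ?_)) (Subtype.map_injective _ Function.injective_id)
    have hA' := not_lt.mp hA
    have : Q / 6 ≤ Q * T / 3 := by nlinarith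
    exact hA'.trans this
  exact_mod_cast this
end
end

section
/- (Combinatorial core of the correctness of BucketAndCombine.) Let N be a positive integer, let C be a finite set with 3·|C| ≤ N, and let f : {1,…,N} → C be any function. Then there exist ⌊N/3⌋ pairwise disjoint unordered pairs {i₁,j₁},…,{i_{⌊N/3⌋}, j_{⌊N/3⌋}} of distinct indices in {1,…,N} such that f(i_k) = f(j_k) for every k. -/
theorem bucket_aux {N : ℕ} {C : Type*} [Fintype C] (f : Fin N → C) (m : ℕ) :
    ∀ S : Finset (Fin N), 2 * m + Fintype.card C ≤ S.card →
    ∃ P : Fin m → Fin N × Fin N,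
      (∀ k, (P k).1 ∈ S ∧ (P k).2 ∈ S) ∧
      (∀ k, (P k).1 ≠ (P k).2 ∧ f (P k).1 = f (P k).2) ∧
      (∀ k l, k ≠ l → (P k).1 ≠ (P l).1 ∧ (P k).1 ≠ (P l).2 ∧
        (P k).2 ≠ (P l).1 ∧ (P k).2 ≠ (P l).2) := by
  induction m with
  | zero => exact fun S _ => ⟨fun k => k.elim0, fun k => k.elim0, fun k => k.elim0, fun k => k.elim0⟩
  | succ m ih =>
    intro S hS
    obtain ⟨x, hx, y, hy, hxy, hf⟩ := Finset.exists_ne_map_eq_of_card_lt_of_maps_to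
      (s := S) (t := (Finset.univ : Finset C)) (f := f)
      (by rw [Finset.card_univ]; omega) (fun _ _ => by simp)
    have h1 := Finset.card_erase_of_mem hx
    have h2 := Finset.card_erase_of_mem (Finset.mem_erase.2 ⟨hxy.symm, hy⟩)
    obtain ⟨P, hP, hQ, hR⟩ := ih ((S.erase x).erase y) (by omega)
    simp only [Finset.mem_erase] at hP
    refine ⟨Fin.cons (x, y) P, ?_, ?_, ?_⟩
    · intro k
      refine Fin.cases ?_ (fun k => ?_) k
      · exact ⟨hx, hy⟩
      · exact ⟨(hP k).1.2.2, (hP k).2.2.2⟩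
    · intro k
      refine Fin.cases ?_ (fun k => ?_) k
      · exact ⟨hxy, hf⟩
      · exact hQ k
    · intro k l
      refine Fin.cases ?_ (fun k => ?_) k <;> refine Fin.cases ?_ (fun l => ?_) l
      · intro h; exact absurd rfl h
      · intro _
        have := hP l
        simp only [Fin.cons_zero, Fin.cons_succ]
        grind
      · intro _
        have := hP k
        simp only [Fin.cons_zero, Fin.cons_succ]
        grind
      · intro h
        exact hR k l (fun e => h (by rw [e]))

/-- (Combinatorial core of the correctness of BucketAndCombine.)
If `C` is a finite set with `3·|C| ≤ N` and `f : {1,…,N} → C`, then one can find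
`⌊N/3⌋` pairwise disjoint unordered pairs of distinct indices on which `f` collides. -/
theorem bucket_and_combine_pairs (N : ℕ) (hN : 0 < N) (C : Type*) [Fintype C]
    (hC : 3 * Fintype.card C ≤ N) (f : Fin N → C) :
    ∃ P : Fin (N / 3) → Fin N × Fin N,
      (∀ k, (P k).1 ≠ (P k).2 ∧ f (P k).1 = f (P k).2) ∧
      (∀ k l, k ≠ l →
        ({(P k).1, (P k).2} : Set (Fin N)) ∩ {(P l).1, (P l).2} = ∅) := by
  obtain ⟨P, -, hQ, hR⟩ := bucket_aux f (N / 3) Finset.univ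
    (by rw [Finset.card_univ, Fintype.card_fin]; omega)
  refine ⟨P, hQ, fun k l h => ?_⟩
  have := hR k l h
  ext z
  simp only [Set.mem_inter_iff, Set.mem_insert_iff, Set.mem_singleton_iff, Set.mem_empty_iff_false]
  grind
end
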